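/- Both characteristic fields of the modified Shallow Water system are genuinely nonlinear on \(\Omega=\{(h,q):0<q,\ 0<h<(16q)^{1/3}\}\): with \(\lambda_\pm(h,q)=q/h\pm h\sqrt{q/h}\) and eigenvectors \(R_\pm=(1,\lambda_\pm)^T\), one has \(\nabla\lambda_\pm(h,q)\cdot R_\pm(h,q)\neq 0\) for all \((h,q)\in\Omega\). -/

import Mathlib

/-- The speed `q/h + ε h √(q/h)` differentiated along `(1, λ)`, for a sign `ε`. -/
theorem deriv_speed_along_eigenvector (ε h s : ℝ) (hε : ε ^ 2 = 1) (hh : 0 < h) (hs : 0 < s) :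
    deriv (fun h' : ℝ => h * s ^ 2 / h' + ε * (h' * Real.sqrt (h * s ^ 2 / h'))) h
      + deriv (fun q' : ℝ => q' / h + ε * (h * Real.sqrt (q' / h))) (h * s ^ 2)
        * (s ^ 2 + ε * (h * s)) = h / 2 + 2 * ε * s := by
  have hdiv : h * s ^ 2 / h = s ^ 2 := by field_simp
  have hsqrt : Real.sqrt (h * s ^ 2 / h) = s := by rw [hdiv, Real.sqrt_sq hs.le]
  have hne : h * s ^ 2 / h ≠ 0 := by rw [hdiv]; positivity
  have hd : HasDerivAt (fun h' : ℝ => h * s ^ 2 / h') _ h :=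
    (hasDerivAt_const h (h * s ^ 2)).fun_div (hasDerivAt_id' h) hh.ne'
  have hq : HasDerivAt (fun q' : ℝ => q' / h) _ (h * s ^ 2) :=
    (hasDerivAt_id' (h * s ^ 2)).div_const h
  have h₁ := hd.fun_add (((hasDerivAt_id' h).fun_mul (hd.sqrt hne)).const_mul ε)
  have h₂ := hq.fun_add (((hq.sqrt hne).const_mul h).const_mul ε)
  rw [h₁.deriv, h₂.deriv, hsqrt]
  field_simp
  linear_combination (h ^ 2 * s) * hε

/-- Both characteristic fields of the modified Shallow Water system are
genuinely nonlinear on `Ω`: with `λ± = q/h ± h√(q/h)` and `R± = (1, λ±)ᵀ`, one has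
`∇λ± · R± ≠ 0` on `Ω`. The gradient is with respect to the conserved variables
`(h, q)`. -/
theorem modifiedSW_genuinely_nonlinear (h q : ℝ) (hq : 0 < q) (hh : 0 < h)
    (hup : h ^ 3 < 16 * q) :
    (deriv (fun h' : ℝ => q / h' + h' * Real.sqrt (q / h')) h
        + deriv (fun q' : ℝ => q' / h + h * Real.sqrt (q' / h)) q
          * (q / h + h * Real.sqrt (q / h)) ≠ 0) ∧
    (deriv (fun h' : ℝ => q / h' - h' * Real.sqrt (q / h')) h
        + deriv (fun q' : ℝ => q' / h - h * Real.sqrt (q' / h)) q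
          * (q / h - h * Real.sqrt (q / h)) ≠ 0) := by
  obtain ⟨s, hs, rfl⟩ : ∃ s : ℝ, 0 < s ∧ q = h * s ^ 2 := by
    refine ⟨Real.sqrt (q / h), Real.sqrt_pos.2 (by positivity), ?_⟩
    rw [Real.sq_sqrt (by positivity)]
    field_simp
  have hdiv : h * s ^ 2 / h = s ^ 2 := by field_simp
  have hlt : h < 4 * s := by
    by_contra! hle
    nlinarith [mul_le_mul_of_nonneg_left (pow_le_pow_left₀ (by positivity) hle 2) hh.le]
  rw [hdiv, Real.sqrt_sq hs.le]
  constructor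
  · have key := deriv_speed_along_eigenvector 1 h s (by norm_num) hh hs
    simp only [one_mul] at key
    rw [key]
    positivity
  · have key := deriv_speed_along_eigenvector (-1) h s (by norm_num) hh hs
    simp only [neg_one_mul, ← sub_eq_add_neg] at key
    rw [key]
    exact (by linarith : h / 2 + 2 * -1 * s < 0).ne
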